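/- arXiv:1212.5015 — 13 statements merged into one kernel-verified Lean document; each statement's English description precedes it below -/
import Mathlib

section
/- Let P be a set, A a commutative ring, [·,·] a linking number on P with values in A, and α ∈ A. Then there is a unique A-bilinear map {·,·}_α : L(P) × L(P) → L(P) which is antisymmetric, satisfies the Leibniz rule {a·b, c}_α = a·{b,c}_α + b·{a,c}_α in each argument, and takes the value {Xx, Yy}_α = [Xx,Yy]·(Xy·Yx + α·Xx·Yy) on every pair of generators; moreover this bracket satisfies the Jacobi identity, so that L(P) equipped with its product and {·,·}_α is a Poisson algebra (the swapping algebra). -/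
/-- A linking number on a set `P` with values in a commutative ring `A`:
a map `(X,x,Y,y) ↦ [Xx,Yy]` satisfying the two antisymmetries, the cocycle
identity, degeneracy, and the linking number alternative. -/
structure LinkingNumber (P : Type*) (A : Type*) [CommRing A] where
  l : P → P → P → P → A
  antisymm_fst : ∀ X x Y y : P, l X x Y y + l Y y X x = 0
  antisymm_snd : ∀ X x Y y : P, l X x Y y + l X x y Y = 0
  cocycle : ∀ z y X Y Z : P, l z y X Y + l z y Y Z + l z y Z X = 0
  degenerate : ∀ X Y y : P, l X X Y y = 0
  alternative : ∀ X x Y y : P, X ≠ x → X ≠ Y → X ≠ y → x ≠ Y → x ≠ y → Y ≠ y →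
    l X x Y y * l X y Y x = 0

/-- The commutative algebra `L(P)`: polynomials with variables the ordered pairs of
distinct points of `P`. -/
abbrev SwapAlg (P A : Type*) [CommRing A] := MvPolynomial {q : P × P // q.1 ≠ q.2} A

/-- The generator `Xx` of `L(P)`: the variable `(X,x)` when `X ≠ x`, and `0` when `X = x`. -/
noncomputable def swapGen (P : Type*) (A : Type*) [CommRing A] [DecidableEq P] (X x : P) :
    SwapAlg P A :=
  if h : X = x then 0 else MvPolynomial.X ⟨(X, x), h⟩

namespace SwapAux

variable {P A : Type*} [CommRing A]

/-- The linking number comes from an antisymmetric bilinear form. -/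
theorem exists_form (ℓ : LinkingNumber P A) (o : P) : ∃ g : P → P → A,
    (∀ a b, g a b = - g b a) ∧
    ∀ X x Y y : P, ℓ.l X x Y y = g x y - g x Y - g X y + g X Y := by
  refine ⟨fun a b => ℓ.l o a o b, fun a b =>
    eq_neg_of_add_eq_zero_left (ℓ.antisymm_fst o a o b), fun X x Y y => ?_⟩
  have key : ∀ a b c d : P, ℓ.l a b c d = ℓ.l a b o d - ℓ.l a b o c := by
    intro a b c d
    have h1 := ℓ.cocycle a b o c d
    have h2 := ℓ.antisymm_snd a b o d
    linear_combination h1 - h2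
  have key2 : ∀ a b c d : P, ℓ.l a b c d = ℓ.l o b c d - ℓ.l o a c d := by
    intro a b c d
    have h1 := key c d a b
    have h2 := ℓ.antisymm_fst a b c d
    have h3 := ℓ.antisymm_fst o b c d
    have h4 := ℓ.antisymm_fst o a c d
    have h5 := ℓ.antisymm_fst c d o b
    linear_combination h2 - h1 - h3 + h4
  simp only [key X x Y y, key2 X x o y, key2 X x o Y]
  ring

/-- A vanishing product in which only the relevant pairs need to be distinct. -/
theorem alt_of_ne (ℓ : LinkingNumber P A) (X x Y y : P) (h1 : X ≠ Y) (h2 : x ≠ y) :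
    ℓ.l X x Y y * ℓ.l X y Y x = 0 := by
  have hd : ∀ a b c : P, ℓ.l a b c c = 0 := by
    intro a b c
    have := ℓ.antisymm_fst a b c c
    rw [ℓ.degenerate] at this
    simpa using this
  by_cases h3 : X = x
  · subst h3; rw [ℓ.degenerate]; ring
  by_cases h4 : X = y
  · subst h4; rw [ℓ.degenerate X Y x]; ring
  by_cases h5 : x = Y
  · subst h5; rw [hd X y]; ring
  by_cases h6 : Y = y
  · subst h6; rw [hd X x]; ring
  exact ℓ.alternative X x Y y h3 h1 h4 h5 h2 h6

/-- The coefficient appearing in the Jacobi identity. -/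
def T (ℓ : LinkingNumber P A) (X x Y y Z z : P) : A :=
  ℓ.l X x Y y * ℓ.l Y x Z z + ℓ.l Y y Z z * ℓ.l Z y X x + ℓ.l Z z X x * ℓ.l X z Y y

theorem T_rot (ℓ : LinkingNumber P A) (X x Y y Z z : P) :
    T ℓ X x Y y Z z = T ℓ Y y Z z X x := by
  unfold T; ring

theorem T_zero_aux (ℓ : LinkingNumber P A) (X x Y y Z z : P)
    (h1 : X ≠ x) (h2 : Y ≠ y) (h3 : Z ≠ z) (h4 : X ≠ y) (h5 : Y ≠ z) (h6 : Z ≠ x)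
    (hXY : X ≠ Y) (hx : ¬ (x = y ∧ x = z)) : T ℓ X x Y y Z z = 0 := by
  obtain ⟨g, hs, hl⟩ := exists_form ℓ X
  have hq : ∀ a, g a a = - g a a := fun a => hs a a
  have s1 := hs x Y
  have s2 := hs x y
  have s3 := hs x Z
  have s4 := hs x z
  have s5 := hs Y y
  have s6 := hs Y Z
  have s7 := hs Y z
  have s8 := hs y Z
  have s9 := hs y z
  have s10 := hs Z z
  have s11 := hs X x
  have s12 := hs X Y
  have s13 := hs X y
  have s14 := hs X Z
  have s15 := hs X z
  by_cases hxy : x = y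
  · have hxz : x ≠ z := fun h => hx ⟨hxy, h⟩
    have e1 := alt_of_ne ℓ X x Y Z hXY h6.symm
    have e2 := alt_of_ne ℓ X x Y z hXY hxz
    have e3 := alt_of_ne ℓ X x y Z h4 h6.symm
    have e4 := alt_of_ne ℓ X x y z h4 hxz
    unfold T
    clear hxy hxz hx hXY h1 h2 h3 h4 h5 h6
    simp only [hl, s1, s2, s3, s4, s5, s6, s7, s8, s9, s10, s11, s12, s13, s14, s15]
      at e1 e2 e3 e4 ⊢
    linear_combination e1 - e2 - e3 + e4
  · have e1 := alt_of_ne ℓ X x Y y hXY hxy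
    have e2 := alt_of_ne ℓ X x Y Z hXY h6.symm
    have e3 := alt_of_ne ℓ X x y Z h4 h6.symm
    have e4 := alt_of_ne ℓ X Y y z h4 h5
    have e5 := alt_of_ne ℓ x Y y z hxy h5
    unfold T
    clear hxy hx hXY h1 h2 h3 h4 h5 h6
    simp only [hl, s1, s2, s3, s4, s5, s6, s7, s8, s9, s10, s11, s12, s13, s14, s15]
      at e1 e2 e3 e4 e5 ⊢
    linear_combination - e1 + e2 - e3 + e4 - e5

theorem T_zero (ℓ : LinkingNumber P A) (X x Y y Z z : P)
    (h1 : X ≠ x) (h2 : Y ≠ y) (h3 : Z ≠ z) (h4 : X ≠ y) (h5 : Y ≠ z) (h6 : Z ≠ x)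
    (hX : ¬ (X = Y ∧ X = Z)) (hx : ¬ (x = y ∧ x = z)) : T ℓ X x Y y Z z = 0 := by
  by_cases hXY : X = Y
  · have hYZ : Y ≠ Z := fun h => hX ⟨hXY, hXY.trans h⟩
    rw [T_rot]
    exact T_zero_aux ℓ Y y Z z X x h2 h3 h1 h5 h6 h4 hYZ
      (fun h => hx ⟨h.2.symm, h.2.symm.trans h.1⟩)
  · exact T_zero_aux ℓ X x Y y Z z h1 h2 h3 h4 h5 h6 hXY hx

theorem T_add_fst (ℓ : LinkingNumber P A) (X x y z : P) :
    T ℓ X x X y X z + T ℓ x X y X z X = 0 := by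
  obtain ⟨g, hs, hl⟩ := exists_form ℓ X
  have s1 := hs x y
  have s2 := hs x z
  have s3 := hs y z
  have s4 := hs X x
  have s5 := hs X y
  have s6 := hs X z
  have q4 := hs X X
  unfold T
  simp only [hl, s1, s2, s3, s4, s5, s6]
  linear_combination (- g y x + g z x - g z y + 3 * g X X) * q4

theorem T_add_snd (ℓ : LinkingNumber P A) (x X Y Z : P) :
    T ℓ X x Y x Z x + T ℓ x X x Y x Z = 0 := by
  rw [add_comm]; exact T_add_fst ℓ x X Y Z

variable [DecidableEq P]

theorem gen_self (X : P) : swapGen P A X X = 0 := by simp [swapGen]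

theorem gen_of_ne (q : {q : P × P // q.1 ≠ q.2}) :
    (MvPolynomial.X q : SwapAlg P A) = swapGen P A q.1.1 q.1.2 := by
  obtain ⟨⟨a, b⟩, h⟩ := q
  have h' : a ≠ b := h
  simp [swapGen, h']

theorem T_gen (ℓ : LinkingNumber P A) (X x Y y Z z : P)
    (h1 : X ≠ x) (h2 : Y ≠ y) (h3 : Z ≠ z)
    (hX : ¬ (X = Y ∧ X = Z)) (hx : ¬ (x = y ∧ x = z)) :
    MvPolynomial.C (T ℓ X x Y y Z z) *
      (swapGen P A X y * swapGen P A Y z * swapGen P A Z x) = 0 := by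
  by_cases h4 : X = y
  · subst h4; simp [gen_self]
  by_cases h5 : Y = z
  · subst h5; simp [gen_self]
  by_cases h6 : Z = x
  · subst h6; simp [gen_self]
  rw [T_zero ℓ X x Y y Z z h1 h2 h3 h4 h5 h6 hX hx]
  simp

theorem T_gen_rev (ℓ : LinkingNumber P A) (X x Y y Z z : P)
    (h1 : X ≠ x) (h2 : Y ≠ y) (h3 : Z ≠ z)
    (hX : ¬ (X = Y ∧ X = Z)) (hx : ¬ (x = y ∧ x = z)) :
    MvPolynomial.C (T ℓ x X y Y z Z) *
      (swapGen P A Y x * swapGen P A Z y * swapGen P A X z) = 0 := by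
  by_cases h4 : x = Y
  · subst h4; simp [gen_self]
  by_cases h5 : y = Z
  · subst h5; simp [gen_self]
  by_cases h6 : z = X
  · subst h6; simp [gen_self]
  rw [T_zero ℓ x X y Y z Z h1.symm h2.symm h3.symm h4 h5 h6 hx hX]
  simp

theorem T_sum (ℓ : LinkingNumber P A) (X x Y y Z z : P)
    (h1 : X ≠ x) (h2 : Y ≠ y) (h3 : Z ≠ z) :
    MvPolynomial.C (T ℓ X x Y y Z z) *
      (swapGen P A X y * swapGen P A Y z * swapGen P A Z x) +
    MvPolynomial.C (T ℓ x X y Y z Z) *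
      (swapGen P A Y x * swapGen P A Z y * swapGen P A X z) = 0 := by
  by_cases hX : X = Y ∧ X = Z
  · obtain ⟨rfl, rfl⟩ := hX
    have h := congrArg (MvPolynomial.C (σ := {q : P × P // q.1 ≠ q.2})) (T_add_fst ℓ X x y z)
    rw [map_add, map_zero] at h
    linear_combination (swapGen P A X y * swapGen P A X z * swapGen P A X x) * h
  by_cases hx : x = y ∧ x = z
  · obtain ⟨rfl, rfl⟩ := hx
    have h := congrArg (MvPolynomial.C (σ := {q : P × P // q.1 ≠ q.2})) (T_add_snd ℓ x X Y Z)
    rw [map_add, map_zero] at h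
    linear_combination (swapGen P A X x * swapGen P A Y x * swapGen P A Z x) * h
  rw [T_gen ℓ X x Y y Z z h1 h2 h3 hX hx, T_gen_rev ℓ X x Y y Z z h1 h2 h3 hX hx, add_zero]

theorem leibniz_C {B : SwapAlg P A →ₗ[A] SwapAlg P A →ₗ[A] SwapAlg P A}
    (hB : ∀ a b c, B (a * b) c = a * B b c + b * B a c) (r : A) (c : SwapAlg P A) :
    B (MvPolynomial.C r) c = 0 := by
  have h := hB 1 1 c
  simp only [one_mul] at h
  have h1 : B 1 c = 0 := by linear_combination -h
  have h2 : (MvPolynomial.C r : SwapAlg P A) = r • 1 := by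
    rw [MvPolynomial.smul_eq_C_mul, mul_one]
  rw [h2, map_smul, LinearMap.smul_apply, h1, smul_zero]

theorem jacobi_gen (ℓ : LinkingNumber P A) (α : A)
    (B : SwapAlg P A →ₗ[A] SwapAlg P A →ₗ[A] SwapAlg P A)
    (hL : ∀ a b c, B (a * b) c = a * B b c + b * B a c)
    (hG : ∀ X x Y y : P, B (swapGen P A X x) (swapGen P A Y y) =
         MvPolynomial.C (ℓ.l X x Y y) *
           (swapGen P A X y * swapGen P A Y x
             + MvPolynomial.C α * (swapGen P A X x * swapGen P A Y y)))
    (X x Y y Z z : P) (h1 : X ≠ x) (h2 : Y ≠ y) (h3 : Z ≠ z) :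
    B (B (swapGen P A X x) (swapGen P A Y y)) (swapGen P A Z z) +
    B (B (swapGen P A Y y) (swapGen P A Z z)) (swapGen P A X x) +
    B (B (swapGen P A Z z) (swapGen P A X x)) (swapGen P A Y y) = 0 := by
  have key := T_sum ℓ X x Y y Z z h1 h2 h3
  obtain ⟨g, hs, hl⟩ := exists_form ℓ X
  simp only [hG, hL, map_add, LinearMap.add_apply, leibniz_C hL]
  simp only [T, hl, map_add, map_sub, map_mul] at key ⊢
  have hC : ∀ a b, MvPolynomial.C (σ := {q : P × P // q.1 ≠ q.2}) (g a b)
      = - MvPolynomial.C (g b a) := fun a b => by rw [hs a b, map_neg]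
  have s1 := hC x Y
  have s2 := hC x y
  have s3 := hC x Z
  have s4 := hC x z
  have s5 := hC Y y
  have s6 := hC Y Z
  have s7 := hC Y z
  have s8 := hC y Z
  have s9 := hC y z
  have s10 := hC Z z
  have s11 := hC X x
  have s12 := hC X Y
  have s13 := hC X y
  have s14 := hC X Z
  have s15 := hC X z
  simp only [s1, s2, s3, s4, s5, s6, s7, s8, s9, s10, s11, s12, s13, s14, s15] at key ⊢
  linear_combination key

theorem jacobi_step (B : SwapAlg P A →ₗ[A] SwapAlg P A →ₗ[A] SwapAlg P A)
    (hA : ∀ a b, B a b = - B b a)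
    (hL : ∀ a b c, B (a * b) c = a * B b c + b * B a c)
    (hR : ∀ a b c, B a (b * c) = b * B a c + c * B a b)
    (b c : SwapAlg P A)
    (h : ∀ i, B (B (MvPolynomial.X i) b) c + B (B b c) (MvPolynomial.X i)
      + B (B c (MvPolynomial.X i)) b = 0) (a : SwapAlg P A) :
    B (B a b) c + B (B b c) a + B (B c a) b = 0 := by
  induction a using MvPolynomial.induction_on with
  | C r =>
    rw [hA (B b c), hA c, leibniz_C hL, leibniz_C hL]
    simp [leibniz_C hL]
  | add p q hp hq =>
    simp only [map_add, LinearMap.add_apply]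
    linear_combination hp + hq
  | mul_X p i hp =>
    have hi := h i
    simp only [hL, hR, map_add, LinearMap.add_apply]
    have e1 := hA c p
    have e2 := hA c (MvPolynomial.X i)
    linear_combination MvPolynomial.X i * hp + p * hi
      + B (MvPolynomial.X i) b * e1 + B p b * e2

theorem jacobi (ℓ : LinkingNumber P A) (α : A)
    (B : SwapAlg P A →ₗ[A] SwapAlg P A →ₗ[A] SwapAlg P A)
    (hA : ∀ a b, B a b = - B b a)
    (hL : ∀ a b c, B (a * b) c = a * B b c + b * B a c)
    (hR : ∀ a b c, B a (b * c) = b * B a c + c * B a b)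
    (hG : ∀ X x Y y : P, B (swapGen P A X x) (swapGen P A Y y) =
         MvPolynomial.C (ℓ.l X x Y y) *
           (swapGen P A X y * swapGen P A Y x
             + MvPolynomial.C α * (swapGen P A X x * swapGen P A Y y)))
    (a b c : SwapAlg P A) : B (B a b) c + B (B b c) a + B (B c a) b = 0 := by
  refine jacobi_step B hA hL hR b c (fun i => ?_) a
  have h2 := jacobi_step B hA hL hR c (MvPolynomial.X i) (fun j => ?_) b
  · linear_combination h2
  have h3 := jacobi_step B hA hL hR (MvPolynomial.X i) (MvPolynomial.X j) (fun k => ?_) c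
  · linear_combination h3
  rw [gen_of_ne i, gen_of_ne j, gen_of_ne k]
  exact jacobi_gen ℓ α B hL hG _ _ _ _ _ _ k.2 i.2 j.2

theorem ext_leibniz (B B' : SwapAlg P A →ₗ[A] SwapAlg P A →ₗ[A] SwapAlg P A)
    (hL : ∀ a b c, B (a * b) c = a * B b c + b * B a c)
    (hL' : ∀ a b c, B' (a * b) c = a * B' b c + b * B' a c) (c : SwapAlg P A)
    (h : ∀ i, B (MvPolynomial.X i) c = B' (MvPolynomial.X i) c) (a : SwapAlg P A) :
    B a c = B' a c := by
  induction a using MvPolynomial.induction_on with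
  | C r => rw [leibniz_C hL, leibniz_C hL']
  | add p q hp hq => simp only [map_add, LinearMap.add_apply, hp, hq]
  | mul_X p i hp => rw [hL, hL', hp, h]

/-- The swapping bracket, as a derivation with values in derivations. -/
noncomputable def swapDer (ℓ : LinkingNumber P A) (α : A) :
    Derivation A (SwapAlg P A) (Derivation A (SwapAlg P A) (SwapAlg P A)) :=
  MvPolynomial.mkDerivation A fun i => MvPolynomial.mkDerivation A fun j =>
    MvPolynomial.C (ℓ.l i.1.1 i.1.2 j.1.1 j.1.2) *
      (swapGen P A i.1.1 j.1.2 * swapGen P A j.1.1 i.1.2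
        + MvPolynomial.C α * (swapGen P A i.1.1 i.1.2 * swapGen P A j.1.1 j.1.2))

/-- The swapping bracket, as a bilinear map. -/
noncomputable def swapB (ℓ : LinkingNumber P A) (α : A) :
    SwapAlg P A →ₗ[A] SwapAlg P A →ₗ[A] SwapAlg P A :=
  LinearMap.mk₂ A (fun a b => swapDer ℓ α a b)
    (fun a b c => by simp) (fun r a b => by simp) (fun a b c => by simp) (fun r a b => by simp)

theorem swapB_left (ℓ : LinkingNumber P A) (α : A) (a b c : SwapAlg P A) :
    swapB ℓ α (a * b) c = a * swapB ℓ α b c + b * swapB ℓ α a c := by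
  simp [swapB]

theorem swapB_right (ℓ : LinkingNumber P A) (α : A) (a b c : SwapAlg P A) :
    swapB ℓ α a (b * c) = b * swapB ℓ α a c + c * swapB ℓ α a b := by
  simp [swapB]

theorem swapB_gen (ℓ : LinkingNumber P A) (α : A) (X x Y y : P) :
    swapB ℓ α (swapGen P A X x) (swapGen P A Y y) =
         MvPolynomial.C (ℓ.l X x Y y) *
           (swapGen P A X y * swapGen P A Y x
             + MvPolynomial.C α * (swapGen P A X x * swapGen P A Y y)) := by
  by_cases h : X = x
  · subst h
    rw [ℓ.degenerate]; simp [gen_self]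
  by_cases h' : Y = y
  · subst h'
    have := ℓ.antisymm_fst X x Y Y
    rw [ℓ.degenerate, add_zero] at this
    rw [this]; simp [gen_self]
  have e1 := gen_of_ne (A := A) (⟨(X, x), h⟩ : {q : P × P // q.1 ≠ q.2})
  have e2 := gen_of_ne (A := A) (⟨(Y, y), h'⟩ : {q : P × P // q.1 ≠ q.2})
  simp only at e1 e2
  rw [← e1, ← e2]
  simp only [swapB, swapDer, LinearMap.mk₂_apply, MvPolynomial.mkDerivation_X]
  rw [e1, e2]

theorem swapB_antisymm (ℓ : LinkingNumber P A) (α : A) (a b : SwapAlg P A) :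
    swapB ℓ α a b = - swapB ℓ α b a := by
  have hL := swapB_left ℓ α
  have hR := swapB_right ℓ α
  have hL' : ∀ a b c, (-(swapB ℓ α).flip) (a * b) c =
      a * (-(swapB ℓ α).flip) b c + b * (-(swapB ℓ α).flip) a c := by
    intro a b c
    simp only [LinearMap.neg_apply, LinearMap.flip_apply, hR]
    ring
  have key : ∀ a b, (∀ i, swapB ℓ α (MvPolynomial.X i) b = - swapB ℓ α b (MvPolynomial.X i)) →
      swapB ℓ α a b = - swapB ℓ α b a := fun a b h =>
    ext_leibniz (swapB ℓ α) (-(swapB ℓ α).flip) hL hL' b h a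
  refine key a b fun i => ?_
  rw [key b (MvPolynomial.X i) fun j => ?_, neg_neg]
  rw [gen_of_ne i, gen_of_ne j, swapB_gen, swapB_gen,
    eq_neg_of_add_eq_zero_left (ℓ.antisymm_fst j.1.1 j.1.2 i.1.1 i.1.2), map_neg]
  ring

end SwapAux

/-- Theorem (Swapping bracket): there is a unique `A`-bilinear, antisymmetric map on `L(P)`
satisfying the Leibniz rule in each argument and taking the prescribed value
`{Xx,Yy}_α = [Xx,Yy]·(Xy·Yx + α·Xx·Yy)` on generators; moreover it satisfies the Jacobi
identity, so `L(P)` becomes a Poisson algebra. -/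
theorem swapping_bracket_exists_unique_and_jacobi
    {P A : Type*} [CommRing A] [DecidableEq P]
    (ℓ : LinkingNumber P A) (α : A) :
    (∃! B : SwapAlg P A →ₗ[A] SwapAlg P A →ₗ[A] SwapAlg P A,
      (∀ a b, B a b = - B b a) ∧
      (∀ a b c, B (a * b) c = a * B b c + b * B a c) ∧
      (∀ a b c, B a (b * c) = b * B a c + c * B a b) ∧
      (∀ X x Y y : P, B (swapGen P A X x) (swapGen P A Y y) =
        MvPolynomial.C (ℓ.l X x Y y) *
          (swapGen P A X y * swapGen P A Y x
            + MvPolynomial.C α * (swapGen P A X x * swapGen P A Y y)))) ∧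
    (∀ B : SwapAlg P A →ₗ[A] SwapAlg P A →ₗ[A] SwapAlg P A,
      ((∀ a b, B a b = - B b a) ∧
       (∀ a b c, B (a * b) c = a * B b c + b * B a c) ∧
       (∀ a b c, B a (b * c) = b * B a c + c * B a b) ∧
       (∀ X x Y y : P, B (swapGen P A X x) (swapGen P A Y y) =
         MvPolynomial.C (ℓ.l X x Y y) *
           (swapGen P A X y * swapGen P A Y x
             + MvPolynomial.C α * (swapGen P A X x * swapGen P A Y y)))) →
      ∀ a b c, B (B a b) c + B (B b c) a + B (B c a) b = 0) := by
  refine ⟨⟨SwapAux.swapB ℓ α, ⟨SwapAux.swapB_antisymm ℓ α, SwapAux.swapB_left ℓ α,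
    SwapAux.swapB_right ℓ α, SwapAux.swapB_gen ℓ α⟩, ?_⟩, ?_⟩
  · rintro B ⟨hA, hL, hR, hG⟩
    refine LinearMap.ext fun a => LinearMap.ext fun b => ?_
    refine SwapAux.ext_leibniz B _ hL (SwapAux.swapB_left ℓ α) b (fun i => ?_) a
    rw [hA, SwapAux.swapB_antisymm, neg_inj]
    refine SwapAux.ext_leibniz B _ hL (SwapAux.swapB_left ℓ α) _ (fun j => ?_) b
    rw [SwapAux.gen_of_ne i, SwapAux.gen_of_ne j, hG, SwapAux.swapB_gen]
  · rintro B ⟨hA, hL, hR, hG⟩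
    exact SwapAux.jacobi ℓ α B hA hL hR hG
end

section
/- The canonical linking number on ℝ is a linking number in the abstract sense: for all real numbers it satisfies the first antisymmetry [Xx,Yy] + [Yy,Xx] = 0, the second antisymmetry [Xx,Yy] + [Xx,yY] = 0, the cocycle identity [zy,XY] + [zy,YZ] + [zy,ZX] = 0, the degeneracy relation [XX,Yy] = 0, and the linking number alternative [Xx,Yy]·[Xy,Yx] = 0 whenever X,x,Y,y are pairwise distinct. -/
/-- The canonical linking number of the pairs `(X,x)` and `(Y,y)` of real numbers. -/
noncomputable def rlink (X x Y y : ℝ) : ℝ :=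
  (1 / 2) * (Real.sign (X - x) * Real.sign (X - y) * Real.sign (y - x) -
    Real.sign (X - x) * Real.sign (X - Y) * Real.sign (Y - x))

/-- Every difference of reals has an explicit sign. -/
lemma sign_cases (a b : ℝ) :
    (a < b ∧ Real.sign (a - b) = -1 ∧ Real.sign (b - a) = 1) ∨
    (a = b ∧ Real.sign (a - b) = 0 ∧ Real.sign (b - a) = 0) ∨
    (b < a ∧ Real.sign (a - b) = 1 ∧ Real.sign (b - a) = -1) := by
  rcases lt_trichotomy a b with h | h | h
  · exact Or.inl ⟨h, Real.sign_of_neg (by linarith), Real.sign_of_pos (by linarith)⟩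
  · subst h
    simp
  · exact Or.inr (Or.inr ⟨h, Real.sign_of_pos (by linarith), Real.sign_of_neg (by linarith)⟩)

/-- The canonical linking number on `ℝ` is a linking number in the abstract sense:
it satisfies the two antisymmetries, the cocycle identity, degeneracy, and the
linking number alternative. -/
theorem rlink_is_linking_number :
    (∀ X x Y y : ℝ, rlink X x Y y + rlink Y y X x = 0) ∧
    (∀ X x Y y : ℝ, rlink X x Y y + rlink X x y Y = 0) ∧
    (∀ z y X Y Z : ℝ, rlink z y X Y + rlink z y Y Z + rlink z y Z X = 0) ∧
    (∀ X Y y : ℝ, rlink X X Y y = 0) ∧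
    (∀ X x Y y : ℝ, X ≠ x → X ≠ Y → X ≠ y → x ≠ Y → x ≠ y → Y ≠ y →
      rlink X x Y y * rlink X y Y x = 0) := by
  refine ⟨?_, ?_, ?_, ?_, ?_⟩
  · intro X x Y y
    unfold rlink
    rcases sign_cases X x with ⟨h1, a1, b1⟩ | ⟨h1, a1, b1⟩ | ⟨h1, a1, b1⟩ <;>
    rcases sign_cases X Y with ⟨h2, a2, b2⟩ | ⟨h2, a2, b2⟩ | ⟨h2, a2, b2⟩ <;>
    rcases sign_cases x Y with ⟨h4, a4, b4⟩ | ⟨h4, a4, b4⟩ | ⟨h4, a4, b4⟩ <;>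
    first
    | (exfalso; linarith)
    | (rcases sign_cases X y with ⟨h3, a3, b3⟩ | ⟨h3, a3, b3⟩ | ⟨h3, a3, b3⟩ <;>
       rcases sign_cases x y with ⟨h5, a5, b5⟩ | ⟨h5, a5, b5⟩ | ⟨h5, a5, b5⟩ <;>
       rcases sign_cases Y y with ⟨h6, a6, b6⟩ | ⟨h6, a6, b6⟩ | ⟨h6, a6, b6⟩ <;>
       first
       | (exfalso; linarith)
       | (simp only [a1, a2, a3, a4, a5, a6, b1, b2, b3, b4, b5, b6]; norm_num))
  · intro X x Y y
    unfold rlink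
    ring
  · intro z y X Y Z
    unfold rlink
    ring
  · intro X Y y
    simp [rlink]
  · intro X x Y y n1 n2 n3 n4 n5 n6
    unfold rlink
    rcases sign_cases X x with ⟨h1, a1, b1⟩ | ⟨h1, a1, b1⟩ | ⟨h1, a1, b1⟩ <;>
    rcases sign_cases X Y with ⟨h2, a2, b2⟩ | ⟨h2, a2, b2⟩ | ⟨h2, a2, b2⟩ <;>
    rcases sign_cases x Y with ⟨h4, a4, b4⟩ | ⟨h4, a4, b4⟩ | ⟨h4, a4, b4⟩ <;>
    first
    | contradiction
    | (exfalso; linarith)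
    | (rcases sign_cases X y with ⟨h3, a3, b3⟩ | ⟨h3, a3, b3⟩ | ⟨h3, a3, b3⟩ <;>
       rcases sign_cases x y with ⟨h5, a5, b5⟩ | ⟨h5, a5, b5⟩ | ⟨h5, a5, b5⟩ <;>
       rcases sign_cases Y y with ⟨h6, a6, b6⟩ | ⟨h6, a6, b6⟩ | ⟨h6, a6, b6⟩ <;>
       first
       | contradiction
       | (exfalso; linarith)
       | (simp only [a1, a2, a3, a4, a5, a6, b1, b2, b3, b4, b5, b6]; norm_num))
end

section
/- Let [·,·] be a linking number on a set P with values in a commutative ring A. If X,x,Y,y,Z,z are points of P with {X,x} ∩ {Y,y} ∩ {Z,z} = ∅ (no point common to all three pairs), then F(X,x,Y,y,Z,z) = 0, i.e. [Xx,Yy][Xy,Zz] + [Zz,Xx][Zx,Yy] + [Yy,Zz][Yz,Xx] = 0. -/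
/-- `F(X,x,Y,y,Z,z) := [Xx,Yy][Xy,Zz] + [Zz,Xx][Zx,Yy] + [Yy,Zz][Yz,Xx]`. -/
def LinkingNumber.F {P A : Type*} [CommRing A] (ℓ : LinkingNumber P A)
    (X x Y y Z z : P) : A :=
  ℓ.l X x Y y * ℓ.l X y Z z + ℓ.l Z z X x * ℓ.l Z x Y y + ℓ.l Y y Z z * ℓ.l Y z X x

/-- `G(X,x,Y,y,Z,z) := [Xx,Yy][Yx,Zz] + [Zz,Xx][Xz,Yy] + [Yy,Zz][Zy,Xx]`. -/
def LinkingNumber.G {P A : Type*} [CommRing A] (ℓ : LinkingNumber P A)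
    (X x Y y Z z : P) : A :=
  ℓ.l X x Y y * ℓ.l Y x Z z + ℓ.l Z z X x * ℓ.l X z Y y + ℓ.l Y y Z z * ℓ.l Z y X x

namespace LinkingNumber

variable {P A : Type*} [CommRing A] (ℓ : LinkingNumber P A)

/-- Every bracket splits along a base point `o`. -/
lemma split (o a b c d : P) :
    ℓ.l a b c d = ℓ.l a o c o - ℓ.l a o d o - ℓ.l b o c o + ℓ.l b o d o := by
  have key : ∀ p q r s : P, ℓ.l p q r s = ℓ.l p q r o - ℓ.l p q s o := fun p q r s => by
    linear_combination ℓ.cocycle p q r s o - ℓ.antisymm_snd p q r o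
  have h1 := key a b c d
  have h2 := ℓ.antisymm_fst a b c o
  have h3 := ℓ.antisymm_fst a b d o
  have h4 := key c o a b
  have h5 := key d o a b
  have h6 := ℓ.antisymm_fst a o c o
  have h7 := ℓ.antisymm_fst a o d o
  have h8 := ℓ.antisymm_fst b o c o
  have h9 := ℓ.antisymm_fst b o d o
  linear_combination h1 + h2 - h3 - h4 + h5 - h6 + h7 + h8 - h9

/-- The alternative only needs `X ≠ Y` and `x ≠ y`. -/
lemma alt (X x Y y : P) (h1 : X ≠ Y) (h2 : x ≠ y) : ℓ.l X x Y y * ℓ.l X y Y x = 0 := by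
  have deg : ∀ a b c : P, ℓ.l a b c c = 0 := fun a b c => by
    linear_combination ℓ.antisymm_fst a b c c - ℓ.degenerate c a b
  by_cases h3 : X = x
  · subst h3; simp [ℓ.degenerate]
  by_cases h4 : Y = y
  · subst h4; simp [deg]
  by_cases h5 : X = y
  · subst h5; simp [ℓ.degenerate]
  by_cases h6 : x = Y
  · subst h6; simp [deg]
  exact ℓ.alternative X x Y y h3 h1 h5 h6 h2 h4

lemma F_rot (X x Y y Z z : P) : ℓ.F X x Y y Z z = ℓ.F Y y Z z X x := by
  unfold F; ring

lemma F_swap (X x Y y Z z : P) : ℓ.F X x Y y Z z = - ℓ.F x X Y y Z z := by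
  have s1 : ∀ a b c d : P, ℓ.l a b c d = - ℓ.l b a c d := fun a b c d => by
    rw [ℓ.split a a b c d, ℓ.split a b a c d]; ring
  have s2 : ∀ a b c d e : P, ℓ.l a c d e = ℓ.l a b d e + ℓ.l b c d e := fun a b c d e => by
    rw [ℓ.split a a b d e, ℓ.split a b c d e, ℓ.split a a c d e]; ring
  have s3 := ℓ.antisymm_snd
  have s4 := ℓ.antisymm_fst
  unfold F
  have n1 : ℓ.l Z z x X = - ℓ.l Z z X x := by linear_combination s3 Z z X x
  have n2 : ℓ.l Y z x X = - ℓ.l Y z X x := by linear_combination s3 Y z X x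
  rw [n1, n2, s1 x X Y y, s2 X x y Z z, s2 Z X x Y y]
  linear_combination ℓ.l X x Y y * s4 X x Z z

lemma F_generic (X x Y y Z z : P) (h1 : X ≠ Y) (h2 : X ≠ y) (h3 : x ≠ Z) (h4 : x ≠ z) :
    ℓ.F X x Y y Z z = 0 := by
  have a1 := ℓ.alt X x Y z h1 h4
  have a2 := ℓ.alt X x Y Z h1 h3
  have a3 := ℓ.alt X x y Z h2 h3
  have a4 := ℓ.alt X x y z h2 h4
  have e : ∀ a b c d, ℓ.l a b c d = _ := ℓ.split X
  have z1 : ∀ a, ℓ.l X X a X = 0 := fun a => ℓ.degenerate X a X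
  have z2 : ∀ a, ℓ.l a X X X = 0 := fun a => by
    linear_combination ℓ.antisymm_fst a X X X - ℓ.degenerate X a X
  have t := fun a b => ℓ.antisymm_fst a X b X
  unfold F
  rw [e X x Y z, e X z Y x] at a1
  rw [e X x Y Z, e X Z Y x] at a2
  rw [e X x y Z, e X Z y x] at a3
  rw [e X x y z, e X z y x] at a4
  rw [e X x Y y, e X y Z z, e Z z X x, e Z x Y y, e Y y Z z, e Y z X x]
  simp only [z1, z2] at a1 a2 a3 a4 ⊢
  have r : ∀ a b, ℓ.l a X b X = - ℓ.l b X a X := fun a b => by linear_combination t a b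
  rw [r z Y, r z x] at a1
  rw [r Z Y, r Z x] at a2
  rw [r Z y, r Z x] at a3
  rw [r z y, r z x] at a4
  rw [r Z Y, r Z y, r Z x, r z x, r Y x]
  linear_combination a1 - a2 + a3 - a4

end LinkingNumber

/-- If no point of `P` is common to all three pairs `(X,x)`, `(Y,y)`, `(Z,z)`,
then `F(X,x,Y,y,Z,z) = 0`. -/
theorem linking_number_F_eq_zero {P A : Type*} [CommRing A] (ℓ : LinkingNumber P A)
    (X x Y y Z z : P)
    (h : ({X, x} : Set P) ∩ {Y, y} ∩ {Z, z} = ∅) :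
    ℓ.F X x Y y Z z = 0 := by
  have hh : ∀ p, (p = X ∨ p = x) → (p = Y ∨ p = y) → (p = Z ∨ p = z) → False := by
    intro p h1 h2 h3
    have : p ∈ (({X, x} : Set P) ∩ {Y, y} ∩ {Z, z}) := ⟨⟨h1, h2⟩, h3⟩
    rw [h] at this
    exact this
  have hX := hh X (Or.inl rfl)
  have hx := hh x (Or.inr rfl)
  by_cases c1 : X ≠ Y ∧ X ≠ y ∧ x ≠ Z ∧ x ≠ z
  · exact ℓ.F_generic _ _ _ _ _ _ c1.1 c1.2.1 c1.2.2.1 c1.2.2.2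
  by_cases c2 : x ≠ Y ∧ x ≠ y ∧ X ≠ Z ∧ X ≠ z
  · rw [ℓ.F_swap, ℓ.F_generic _ _ _ _ _ _ c2.1 c2.2.1 c2.2.2.1 c2.2.2.2, neg_zero]
  by_cases hXx : X = x
  · subst hXx
    have d1 := ℓ.degenerate X
    have d2 : ∀ a b, ℓ.l a b X X = 0 := fun a b => by
      linear_combination ℓ.antisymm_fst a b X X - ℓ.degenerate X a b
    simp [LinkingNumber.F, d1, d2]
  -- now `{X, x}` equals `{Y, y}` or `{Z, z}`, so another pair is disjoint from the rest
  by_cases c3 : (X = Y ∨ X = y) ∧ (x = Y ∨ x = y)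
  · rw [ℓ.F_rot, ℓ.F_rot]
    apply ℓ.F_generic <;> grind
  · rw [ℓ.F_rot]
    apply ℓ.F_generic <;> grind
end

section
/- Let [·,·] be a linking number on a set P with values in a commutative ring A. If X,x,Y,y,Z,z are points of P with {X,x} ∩ {Y,y} ∩ {Z,z} = ∅ (no point common to all three pairs), then G(X,x,Y,y,Z,z) = 0, i.e. [Xx,Yy][Yx,Zz] + [Zz,Xx][Xz,Yy] + [Yy,Zz][Zy,Xx] = 0. -/
namespace LinkingNumber

variable {P A : Type*} [CommRing A] (ℓ : LinkingNumber P A)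

theorem degenerate_snd (X x Y : P) : ℓ.l X x Y Y = 0 := by
  have h1 := ℓ.antisymm_fst X x Y Y
  rw [ℓ.degenerate, add_zero] at h1
  exact h1

/-- The alternative also holds when only `a ≠ c` and `b ≠ d` are known. -/
theorem alt_of_ne (a b c d : P) (h1 : a ≠ c) (h2 : b ≠ d) :
    ℓ.l a b c d * ℓ.l a d c b = 0 := by
  by_cases hab : a = b
  · subst hab; simp [ℓ.degenerate]
  by_cases had : a = d
  · subst had; simp [ℓ.degenerate]
  by_cases hbc : b = c
  · subst hbc; simp [ℓ.degenerate_snd]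
  by_cases hcd : c = d
  · subst hcd; simp [ℓ.degenerate_snd]
  exact ℓ.alternative a b c d hab h1 had hbc h2 hcd

/-- A linking number is a difference of values of an antisymmetric form based at `p`. -/
theorem exists_form (p : P) : ∃ w : P → P → A, (∀ a b, w a b + w b a = 0) ∧ (∀ a, w p a = 0) ∧
    (∀ a, w a p = 0) ∧ ∀ a b c d, ℓ.l a b c d = w a c - w a d - w b c + w b d := by
  have key : ∀ a b c d, ℓ.l a b c d = ℓ.l a b c p - ℓ.l a b d p := by
    intro a b c d
    linear_combination ℓ.cocycle a b c d p - ℓ.antisymm_snd a b d p + ℓ.antisymm_snd a b d p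
      - ℓ.antisymm_snd a b p c
  have key2 : ∀ a b c d, ℓ.l a b c d = ℓ.l a p c d - ℓ.l b p c d := by
    intro a b c d
    linear_combination key c d a b * (-1) + ℓ.antisymm_fst a b c d - ℓ.antisymm_fst a p c d
      + ℓ.antisymm_fst b p c d
  refine ⟨fun a b => ℓ.l a p b p, fun a b => ℓ.antisymm_fst a p b p,
    fun a => ℓ.degenerate p a p, fun a => ℓ.degenerate_snd a p p, ?_⟩
  intro a b c d
  linear_combination key a b c d + key2 a b c p - key2 a b d p

/-- The basic quadratic expression of the alternative. -/
def alt_s4 (a b c d : P) : A := ℓ.l a b c d * ℓ.l a d c b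

theorem G_generic (X x Y y Z z : P) : ℓ.G X x Y y Z z =
    ℓ.alt_s4 X x Y Z - ℓ.alt_s4 X x Y z - ℓ.alt_s4 X x y Z + ℓ.alt_s4 X x y z := by
  obtain ⟨w, ha, hp, hq, hl⟩ := ℓ.exists_form X
  simp only [G, alt_s4, hl, hp, hq]
  grind

theorem G_XY (X x y Z z : P) : ℓ.G X x X y Z z = ℓ.alt_s4 X x z y - ℓ.alt_s4 X x Z y := by
  obtain ⟨w, ha, hp, hq, hl⟩ := ℓ.exists_form X
  simp only [G, alt_s4, hl, hp, hq]
  grind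

theorem G_XY_xy (X x Z z : P) : ℓ.G X x X x Z z = ℓ.alt_s4 X x z Z - ℓ.alt_s4 X x Z z := by
  obtain ⟨w, ha, hp, hq, hl⟩ := ℓ.exists_form X
  simp only [G, alt_s4, hl, hp, hq]
  grind

theorem G_Xy (X x Y Z z : P) : ℓ.G X x Y X Z z = ℓ.alt_s4 X x Z Y - ℓ.alt_s4 X x z Y := by
  obtain ⟨w, ha, hp, hq, hl⟩ := ℓ.exists_form X
  simp only [G, alt_s4, hl, hp, hq]
  grind

theorem G_Xy_xY (X x Z z : P) : ℓ.G X x x X Z z = ℓ.alt_s4 X x Z z - ℓ.alt_s4 X x z Z := by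
  obtain ⟨w, ha, hp, hq, hl⟩ := ℓ.exists_form X
  simp only [G, alt_s4, hl, hp, hq]
  grind

theorem G_xZ (X x Y y z : P) : ℓ.G X x Y y x z = ℓ.alt_s4 X x z y - ℓ.alt_s4 X x z Y := by
  obtain ⟨w, ha, hp, hq, hl⟩ := ℓ.exists_form X
  simp only [G, alt_s4, hl, hp, hq]
  grind

theorem G_xZ_Xz (X x Y y : P) : ℓ.G X x Y y x X = ℓ.alt_s4 X x Y y - ℓ.alt_s4 X x y Y := by
  obtain ⟨w, ha, hp, hq, hl⟩ := ℓ.exists_form X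
  simp only [G, alt_s4, hl, hp, hq]
  grind

theorem G_xz (X x Y y Z : P) : ℓ.G X x Y y Z x = ℓ.alt_s4 X x Z Y - ℓ.alt_s4 X x Z y := by
  obtain ⟨w, ha, hp, hq, hl⟩ := ℓ.exists_form X
  simp only [G, alt_s4, hl, hp, hq]
  grind

theorem G_xz_XZ (X x Y y : P) : ℓ.G X x Y y X x = ℓ.alt_s4 X x y Y - ℓ.alt_s4 X x Y y := by
  obtain ⟨w, ha, hp, hq, hl⟩ := ℓ.exists_form X
  simp only [G, alt_s4, hl, hp, hq]
  grind

theorem alt_zero (a b c d : P) (h1 : a ≠ c) (h2 : b ≠ d) : ℓ.alt_s4 a b c d = 0 :=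
  ℓ.alt_of_ne a b c d h1 h2

end LinkingNumber

/-- If no point of `P` is common to all three pairs `(X,x)`, `(Y,y)`, `(Z,z)`,
then `G(X,x,Y,y,Z,z) = 0`. -/
theorem linking_number_G_eq_zero {P A : Type*} [CommRing A] (ℓ : LinkingNumber P A)
    (X x Y y Z z : P)
    (h : ({X, x} : Set P) ∩ {Y, y} ∩ {Z, z} = ∅) :
    ℓ.G X x Y y Z z = 0 := by
  have h' : ∀ p : P, (p = X ∨ p = x) → (p = Y ∨ p = y) → (p = Z ∨ p = z) → False := by
    intro p h1 h2 h3
    have : p ∈ ({X, x} : Set P) ∩ {Y, y} ∩ {Z, z} := ⟨⟨h1, h2⟩, h3⟩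
    rw [h] at this
    exact this
  clear h
  have hX := h' X
  have hx := h' x
  clear h'
  have h0 := ℓ.alt_zero
  by_cases h1 : X = Y
  · subst h1
    by_cases h2 : x = y
    · subst h2
      rw [ℓ.G_XY_xy, h0, h0, sub_zero] <;> grind
    · rw [ℓ.G_XY, h0, h0, sub_zero] <;> grind
  by_cases h3 : X = y
  · subst h3
    by_cases h2 : x = Y
    · subst h2
      rw [ℓ.G_Xy_xY, h0, h0, sub_zero] <;> grind
    · rw [ℓ.G_Xy, h0, h0, sub_zero] <;> grind
  by_cases h4 : x = Z
  · subst h4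
    by_cases h2 : X = z
    · subst h2
      rw [ℓ.G_xZ_Xz, h0, h0, sub_zero] <;> grind
    · rw [ℓ.G_xZ, h0, h0, sub_zero] <;> grind
  by_cases h5 : x = z
  · subst h5
    by_cases h2 : X = Z
    · subst h2
      rw [ℓ.G_xz_XZ, h0, h0, sub_zero] <;> grind
    · rw [ℓ.G_xz, h0, h0, sub_zero] <;> grind
  rw [ℓ.G_generic, h0 _ _ _ _ h1 h4, h0 _ _ _ _ h1 h5, h0 _ _ _ _ h3 h4, h0 _ _ _ _ h3 h5]
  simp
end

section
/- Let [·,·] be a linking number on a set P with values in a commutative ring A. Then for all points X,x,Y,y,Z,z of P one has F(X,x,Y,y,Z,z) + G(X,x,Y,y,Z,z) = 0 and F(X,x,Y,y,Z,z) = −G(Y,y,X,x,Z,z); consequently F is invariant under every permutation of the three pairs (X,x), (Y,y), (Z,z), i.e. F(X,x,Y,y,Z,z) = F(Y,y,X,x,Z,z) = F(Y,y,Z,z,X,x) = F(X,x,Z,z,Y,y), etc. -/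
theorem LinkingNumber.swap_aux {P A : Type*} [CommRing A] (ℓ : LinkingNumber P A)
    (X x Y y U u : P) :
    ℓ.l X y U u + ℓ.l Y x U u = ℓ.l X x U u + ℓ.l Y y U u := by
  linear_combination ℓ.antisymm_fst X y U u + ℓ.antisymm_fst Y x U u
    - ℓ.antisymm_fst X x U u - ℓ.antisymm_fst Y y U u
    - ℓ.cocycle U u X y x - ℓ.cocycle U u Y x y
    + ℓ.antisymm_snd U u x y + ℓ.antisymm_snd U u x X + ℓ.antisymm_snd U u y Y

theorem LinkingNumber.F_add_G {P A : Type*} [CommRing A] (ℓ : LinkingNumber P A)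
    (X x Y y Z z : P) : ℓ.F X x Y y Z z + ℓ.G X x Y y Z z = 0 := by
  unfold LinkingNumber.F LinkingNumber.G
  have a := ℓ.antisymm_fst X x Y y
  have b := ℓ.antisymm_fst Y y Z z
  have c := ℓ.antisymm_fst Z z X x
  linear_combination ℓ.l X x Y y * ℓ.swap_aux X x Y y Z z
    + ℓ.l Z z X x * ℓ.swap_aux Z z X x Y y + ℓ.l Y y Z z * ℓ.swap_aux Y y Z z X x
    + ℓ.l X x Y y * c + ℓ.l Z z X x * b + ℓ.l Y y Z z * a

theorem LinkingNumber.F_eq_neg_G {P A : Type*} [CommRing A] (ℓ : LinkingNumber P A)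
    (X x Y y Z z : P) : ℓ.F X x Y y Z z = - ℓ.G Y y X x Z z := by
  unfold LinkingNumber.F LinkingNumber.G
  linear_combination ℓ.l X y Z z * ℓ.antisymm_fst X x Y y
    + ℓ.l Y z X x * ℓ.antisymm_fst Y y Z z + ℓ.l Z x Y y * ℓ.antisymm_fst Z z X x

theorem LinkingNumber.F_swap_s5 {P A : Type*} [CommRing A] (ℓ : LinkingNumber P A)
    (X x Y y Z z : P) : ℓ.F X x Y y Z z = ℓ.F Y y X x Z z := by
  linear_combination ℓ.F_add_G X x Y y Z z - ℓ.F_eq_neg_G Y y X x Z z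

theorem LinkingNumber.F_cycle {P A : Type*} [CommRing A] (ℓ : LinkingNumber P A)
    (X x Y y Z z : P) : ℓ.F X x Y y Z z = ℓ.F Y y Z z X x := by
  unfold LinkingNumber.F
  ring

/-- For any linking number: `F + G = 0`, `F(X,x,Y,y,Z,z) = −G(Y,y,X,x,Z,z)`, and
consequently `F` is invariant under every permutation of the three pairs
`(X,x)`, `(Y,y)`, `(Z,z)`. -/
theorem linking_number_F_symmetries {P A : Type*} [CommRing A] (ℓ : LinkingNumber P A)
    (X x Y y Z z : P) :
    ℓ.F X x Y y Z z + ℓ.G X x Y y Z z = 0 ∧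
    ℓ.F X x Y y Z z = - ℓ.G Y y X x Z z ∧
    ℓ.F X x Y y Z z = ℓ.F Y y X x Z z ∧
    ℓ.F X x Y y Z z = ℓ.F Y y Z z X x ∧
    ℓ.F X x Y y Z z = ℓ.F Z z X x Y y ∧
    ℓ.F X x Y y Z z = ℓ.F X x Z z Y y ∧
    ℓ.F X x Y y Z z = ℓ.F Z z Y y X x := by
  refine ⟨ℓ.F_add_G .., ℓ.F_eq_neg_G .., ℓ.F_swap_s5 .., ℓ.F_cycle .., (ℓ.F_cycle ..).symm, ?_, ?_⟩
  · rw [ℓ.F_swap_s5 X x Y y Z z, ℓ.F_cycle Y y X x Z z]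
  · rw [ℓ.F_cycle X x Y y Z z, ℓ.F_swap_s5 Y y Z z X x]
end

section
/- Let [·,·] be a linking number on a set P with values in a commutative ring A. Then F satisfies the cocycle equation F(X,x,Y,y,Z,z) + F(x,t,Y,y,Z,z) = F(X,t,Y,y,Z,z) for all points X,x,t,Y,y,Z,z of P, and the antisymmetries F(X,x,Y,y,Z,z) = −F(x,X,Y,y,Z,z) = −F(X,x,y,Y,Z,z) = −F(X,x,Y,y,z,Z). -/
namespace LinkingNumber

variable {P A : Type*} [CommRing A] (ℓ : LinkingNumber P A)

theorem flip (X x Y y : P) : ℓ.l Y y X x = - ℓ.l X x Y y := by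
  linear_combination ℓ.antisymm_fst X x Y y

theorem anti_snd (X x Y y : P) : ℓ.l X x y Y = - ℓ.l X x Y y := by
  linear_combination ℓ.antisymm_snd X x Y y

theorem anti_fst (X x Y y : P) : ℓ.l x X Y y = - ℓ.l X x Y y := by
  linear_combination ℓ.flip Y y x X + ℓ.flip X x Y y - ℓ.antisymm_snd Y y X x

theorem add_snd (Y y X x t : P) : ℓ.l Y y X t = ℓ.l Y y X x + ℓ.l Y y x t := by
  linear_combination ℓ.antisymm_snd Y y X t - ℓ.cocycle Y y X x t

theorem add_fst (X x t Y y : P) : ℓ.l X t Y y = ℓ.l X x Y y + ℓ.l x t Y y := by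
  linear_combination ℓ.flip Y y X t - ℓ.flip Y y X x - ℓ.flip Y y x t - ℓ.add_snd Y y X x t

end LinkingNumber

/-- `F` satisfies the cocycle equation
`F(X,x,Y,y,Z,z) + F(x,t,Y,y,Z,z) = F(X,t,Y,y,Z,z)` and the three antisymmetries. -/
theorem linking_number_F_cocycle_antisym {P A : Type*} [CommRing A]
    (ℓ : LinkingNumber P A) :
    (∀ X x t Y y Z z : P,
      ℓ.F X x Y y Z z + ℓ.F x t Y y Z z = ℓ.F X t Y y Z z) ∧
    (∀ X x Y y Z z : P, ℓ.F X x Y y Z z = - ℓ.F x X Y y Z z) ∧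
    (∀ X x Y y Z z : P, ℓ.F X x Y y Z z = - ℓ.F X x y Y Z z) ∧
    (∀ X x Y y Z z : P, ℓ.F X x Y y Z z = - ℓ.F X x Y y z Z) := by
  refine ⟨?_, ?_, ?_, ?_⟩
  · intro X x t Y y Z z
    simp only [LinkingNumber.F]
    rw [ℓ.add_fst X x t Y y, ℓ.add_fst X x y Z z, ℓ.add_snd Z z X x t, ℓ.add_fst Z x t Y y,
      ℓ.add_snd Y z X x t, ℓ.flip X x Z z]
    ring
  · intro X x Y y Z z
    simp only [LinkingNumber.F]
    rw [ℓ.anti_fst X x Y y, ℓ.anti_snd Z z X x, ℓ.anti_snd Y z X x,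
      ℓ.add_fst X x y Z z, ℓ.add_fst Z X x Y y, ℓ.flip X x Z z]
    ring
  · intro X x Y y Z z
    simp only [LinkingNumber.F]
    rw [ℓ.anti_snd X x Y y, ℓ.anti_snd Z x Y y, ℓ.anti_fst Y y Z z,
      ℓ.add_fst X Y y Z z, ℓ.add_fst Y y z X x, ℓ.flip X x Y y]
    ring
  · intro X x Y y Z z
    simp only [LinkingNumber.F]
    rw [ℓ.anti_snd X y Z z, ℓ.anti_fst Z z X x, ℓ.anti_snd Y y Z z,
      ℓ.add_fst Z z x Y y, ℓ.add_fst Y Z z X x, ℓ.flip Y y Z z]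
    ring
end

section
/- Let [·,·] be a linking number on a set P with values in a commutative ring A. If X,x,Y,y,Z are pairwise distinct points of P, then F(X,x,Y,y,Z,x) = 0. -/
/-- Expansion of a linking number in terms of pairs with base point `o`. -/
lemma LinkingNumber.expand {P A : Type*} [CommRing A] (ℓ : LinkingNumber P A)
    (o a b c d : P) :
    ℓ.l a b c d = ℓ.l o b o d - ℓ.l o b o c - ℓ.l o a o d + ℓ.l o a o c := by
  have key : ∀ u v c d : P, ℓ.l u v c d = ℓ.l u v o d - ℓ.l u v o c := fun u v c d => by
    linear_combination ℓ.cocycle u v o c d - ℓ.antisymm_snd u v o d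
  linear_combination key a b c d + ℓ.antisymm_fst a b o d - ℓ.antisymm_fst a b o c
    - key o d a b + key o c a b - ℓ.antisymm_fst o d o b + ℓ.antisymm_fst o d o a
    + ℓ.antisymm_fst o c o b - ℓ.antisymm_fst o c o a

/-- If `X,x,Y,y,Z` are pairwise distinct then `F(X,x,Y,y,Z,x) = 0`. -/
theorem linking_number_F_repeated_x {P A : Type*} [CommRing A] (ℓ : LinkingNumber P A)
    (X x Y y Z : P)
    (hXx : X ≠ x) (hXY : X ≠ Y) (hXy : X ≠ y) (hXZ : X ≠ Z)
    (hxY : x ≠ Y) (hxy : x ≠ y) (hxZ : x ≠ Z)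
    (hYy : Y ≠ y) (hYZ : Y ≠ Z) (hyZ : y ≠ Z) :
    ℓ.F X x Y y Z x = 0 := by
  have h1 := ℓ.alternative X Y Z x hXY hXZ hXx hYZ hxY.symm hxZ.symm
  have h2 := ℓ.alternative X y Z x hXy hXZ hXx hyZ hxy.symm hxZ.symm
  have z1 : ∀ Q, ℓ.l x x x Q = 0 := fun Q => ℓ.degenerate x x Q
  have sw : ∀ R Q, ℓ.l x R x Q = - ℓ.l x Q x R := fun R Q => by
    linear_combination ℓ.antisymm_fst x R x Q
  have z2 : ∀ Q, ℓ.l x Q x x = 0 := fun Q => by rw [sw, z1, neg_zero]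
  unfold LinkingNumber.F
  rw [ℓ.expand x X Y Z x, ℓ.expand x X x Z Y] at h1
  rw [ℓ.expand x X y Z x, ℓ.expand x X x Z y] at h2
  rw [ℓ.expand x X x Y y, ℓ.expand x X y Z x, ℓ.expand x Z x X x, ℓ.expand x Z x Y y,
    ℓ.expand x Y y Z x, ℓ.expand x Y x X x]
  simp only [z1, z2] at h1 h2 ⊢
  rw [sw Z X, sw Z Y, sw Z y, sw Y X]
  linear_combination h2 - h1
end

section
/- For the canonical linking number on ℝ, if X,x,Y,Z are pairwise distinct real numbers then F(X,x,Y,x,Z,x) ≠ 0, where F(X,x,Y,y,Z,z) := [Xx,Yy][Xy,Zz] + [Zz,Xx][Zx,Yy] + [Yy,Zz][Yz,Xx]. (Thus the hypothesis {X,x} ∩ {Y,y} ∩ {Z,z} = ∅ in the vanishing of F cannot be dropped.) -/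
/-- `F(X,x,Y,y,Z,z) := [Xx,Yy][Xy,Zz] + [Zz,Xx][Zx,Yy] + [Yy,Zz][Yz,Xx]` for the
canonical linking number on `ℝ`. -/
noncomputable def rF (X x Y y Z z : ℝ) : ℝ :=
  rlink X x Y y * rlink X y Z z + rlink Z z X x * rlink Z x Y y +
    rlink Y y Z z * rlink Y z X x

/-- For the canonical linking number on `ℝ`, if `X, x, Y, Z` are pairwise distinct then
`F(X,x,Y,x,Z,x) ≠ 0`: the disjointness hypothesis in the vanishing of `F` cannot be
dropped. -/
theorem rF_ne_zero_of_pairwise_distinct (X x Y Z : ℝ)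
    (hXx : X ≠ x) (hXY : X ≠ Y) (hXZ : X ≠ Z) (hxY : x ≠ Y) (hxZ : x ≠ Z) (hYZ : Y ≠ Z) :
    rF X x Y x Z x ≠ 0 := by
  have key : ∀ t : ℝ, t ≠ 0 → Real.sign t = 1 ∨ Real.sign t = -1 := by
    intro t ht
    rcases lt_or_gt_of_ne ht with h | h
    · exact Or.inr (Real.sign_of_neg h)
    · exact Or.inl (Real.sign_of_pos h)
  have e1 : Real.sign (Y - X) = -Real.sign (X - Y) := by rw [← Real.sign_neg, neg_sub]
  have e2 : Real.sign (Z - X) = -Real.sign (X - Z) := by rw [← Real.sign_neg, neg_sub]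
  have e3 : Real.sign (Z - Y) = -Real.sign (Y - Z) := by rw [← Real.sign_neg, neg_sub]
  unfold rF rlink
  rw [e1, e2, e3, sub_self, Real.sign_zero]
  rcases key _ (sub_ne_zero.2 hXx) with h1 | h1 <;>
  rcases key _ (sub_ne_zero.2 hxY.symm) with h2 | h2 <;>
  rcases key _ (sub_ne_zero.2 hxZ.symm) with h3 | h3 <;>
  rcases key _ (sub_ne_zero.2 hXY) with h4 | h4 <;>
  rcases key _ (sub_ne_zero.2 hXZ) with h5 | h5 <;>
  rcases key _ (sub_ne_zero.2 hYZ) with h6 | h6 <;>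
  rw [h1, h2, h3, h4, h5, h6] <;> norm_num
end

section
/- Let [·,·] be a linking number on a set P with values in a commutative ring A. In the algebra L(P) define P₀(X,x,Y,y,Z,z) := [Xx,Yy][Xy,Zz]·Xz·Yx·Zy + [Xx,Yy][Yx,Zz]·Xy·Yz·Zx. Then for all points X,x,Y,y,Z,z of P the cyclic sum P₀(X,x,Y,y,Z,z) + P₀(Y,y,Z,z,X,x) + P₀(Z,z,X,x,Y,y) equals 0 in L(P) (this is the vanishing of the constant-in-α term of the cyclic sum of triple swapping brackets). -/
/-- `P₀(X,x,Y,y,Z,z) := [Xx,Yy][Xy,Zz]·Xz·Yx·Zy + [Xx,Yy][Yx,Zz]·Xy·Yz·Zx` in `L(P)`. -/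
noncomputable def P0 {P A : Type*} [CommRing A] [DecidableEq P] (ℓ : LinkingNumber P A)
    (X x Y y Z z : P) : SwapAlg P A :=
  MvPolynomial.C (ℓ.l X x Y y * ℓ.l X y Z z) *
      (swapGen P A X z * swapGen P A Y x * swapGen P A Z y) +
    MvPolynomial.C (ℓ.l X x Y y * ℓ.l Y x Z z) *
      (swapGen P A X y * swapGen P A Y z * swapGen P A Z x)

namespace LinkingNumber

variable {P A : Type*} [CommRing A] (ℓ : LinkingNumber P A)

/-- Splitting every linking number through a base point. -/
theorem expand_s10 (O a b c d : P) :
    ℓ.l a b c d = ℓ.l O b O d - ℓ.l O b O c - ℓ.l O a O d + ℓ.l O a O c := by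
  have key : ∀ u v : P, ℓ.l u v c d = ℓ.l u v O d - ℓ.l u v O c := by
    intro u v
    have h1 := ℓ.cocycle u v O c d
    have h2 := ℓ.antisymm_snd u v O d
    linear_combination h1 - h2
  have key2 : ∀ w : P, ℓ.l a b O w = ℓ.l O b O w - ℓ.l O a O w := by
    intro w
    have h1 := ℓ.cocycle O w O a b
    have h2 := ℓ.antisymm_snd O w O b
    have h3 := ℓ.antisymm_fst O w a b
    have h4 := ℓ.antisymm_fst O w O a
    have h5 := ℓ.antisymm_fst O w O b
    linear_combination h3 - h1 + h2 + h4 - h5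
  rw [key, key2, key2]
  ring

/-- The alternative holds as soon as the two opposite pairs are distinct. -/
theorem alt_s10 (a b c d : P) (hac : a ≠ c) (hbd : b ≠ d) :
    ℓ.l a b c d * ℓ.l a d c b = 0 := by
  by_cases h1 : a = b
  · subst h1; simp [ℓ.degenerate]
  by_cases h2 : a = d
  · subst h2; simp [ℓ.degenerate]
  by_cases h3 : b = c
  · subst h3; simp [ℓ.degenerate_snd]
  by_cases h4 : c = d
  · subst h4; simp [ℓ.degenerate_snd]
  exact ℓ.alternative a b c d h1 hac h2 h3 hbd h4

/-- The cyclic coefficient. -/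
def cyc (X x Y y Z z : P) : A :=
  ℓ.l X x Y y * ℓ.l X y Z z + ℓ.l Y y Z z * ℓ.l Y z X x + ℓ.l Z z X x * ℓ.l Z x Y y

theorem cyc_aux (X x Y y Z z : P) (h1 : X ≠ z) (h3 : Z ≠ y)
    (h4 : Y ≠ Z) (h5 : x ≠ z) : ℓ.cyc X x Y y Z z = 0 := by
  have e1 := ℓ.alt_s10 x Y z Z h5 h4
  have e2 := ℓ.alt_s10 X Y z Z h1 h4
  have e3 := ℓ.alt_s10 x y z Z h5 h3.symm
  have e4 := ℓ.alt_s10 X y z Z h1 h3.symm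
  obtain ⟨g, hs, hz, hz', key⟩ : ∃ g : P → P → A, (∀ a b, g a b + g b a = 0) ∧
      (∀ a, g Z a = 0) ∧ (∀ a, g a Z = 0) ∧
      ∀ a b c d, ℓ.l a b c d = g b d - g b c - g a d + g a c :=
    ⟨fun a b => ℓ.l Z a Z b, fun a b => ℓ.antisymm_fst Z a Z b, fun a => ℓ.degenerate Z Z a,
      fun a => ℓ.degenerate_snd Z a Z, fun a b c d => ℓ.expand_s10 Z a b c d⟩
  unfold cyc
  simp only [key, hz, hz'] at e1 e2 e3 e4 ⊢
  have r1 := hs X x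
  have r2 := hs X Y
  have r3 := hs X y
  have r4 := hs X z
  have r5 := hs x Y
  have r6 := hs x y
  have r7 := hs x z
  have r8 := hs Y y
  have r9 := hs Y z
  have r10 := hs y z
  have d1 := hs X X
  have d2 := hs x x
  have d3 := hs Y Y
  have d4 := hs y y
  have d5 := hs z z
  clear key hs hz hz'
  grind

theorem cyc_rot (X x Y y Z z : P) : ℓ.cyc X x Y y Z z = ℓ.cyc Y y Z z X x := by
  unfold cyc
  ring

theorem cyc_zero (X x Y y Z z : P) (h1 : X ≠ z) (h2 : Y ≠ x) (h3 : Z ≠ y)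
    (hU : ¬(X = Y ∧ Y = Z)) (hL : ¬(x = y ∧ y = z)) : ℓ.cyc X x Y y Z z = 0 := by
  by_cases c1 : Y ≠ Z ∧ x ≠ z
  · exact ℓ.cyc_aux X x Y y Z z h1 h3 c1.1 c1.2
  by_cases c2 : Z ≠ X ∧ y ≠ x
  · rw [cyc_rot]
    exact ℓ.cyc_aux Y y Z z X x h2 h1 c2.1 c2.2
  by_cases c3 : X ≠ Y ∧ z ≠ y
  · rw [cyc_rot, cyc_rot]
    exact ℓ.cyc_aux Z z X x Y y h3 h2 c3.1 c3.2
  exfalso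
  grind

theorem swap_both (a b c d : P) : ℓ.l b a d c = ℓ.l a b c d := by
  have h1 := ℓ.antisymm_snd b a d c
  have h2 := ℓ.antisymm_fst b a c d
  have h3 := ℓ.antisymm_snd c d b a
  have h4 := ℓ.antisymm_fst a b c d
  linear_combination h1 - h2 + h3 - h4

/-- If the upper points coincide, the two coefficients cancel. -/
theorem cyc_add_upper (X x y z : P) : ℓ.cyc X x X y X z + ℓ.cyc x X y X z X = 0 := by
  unfold cyc
  have p := ℓ.swap_both
  have h1 := ℓ.antisymm_fst X x X y
  have h2 := ℓ.antisymm_fst X y X z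
  have h3 := ℓ.antisymm_fst X z X x
  rw [p X x X y, p X y X z, p X z X x, p X x X z, p X y X x, p X z X y]
  linear_combination ℓ.l X x X y * h3 + ℓ.l X y X z * h1 + ℓ.l X z X x * h2

end LinkingNumber

/-- The constant-in-`α` term of the cyclic sum of triple swapping brackets vanishes:
`P₀(X,x,Y,y,Z,z) + P₀(Y,y,Z,z,X,x) + P₀(Z,z,X,x,Y,y) = 0` in `L(P)`. -/
theorem cyclic_sum_P0_eq_zero {P A : Type*} [CommRing A] [DecidableEq P]
    (ℓ : LinkingNumber P A) (X x Y y Z z : P) :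
    P0 ℓ X x Y y Z z + P0 ℓ Y y Z z X x + P0 ℓ Z z X x Y y = 0 := by
  classical
  have p := ℓ.swap_both
  have main : P0 ℓ X x Y y Z z + P0 ℓ Y y Z z X x + P0 ℓ Z z X x Y y =
      MvPolynomial.C (ℓ.cyc X x Y y Z z) *
        (swapGen P A X z * swapGen P A Y x * swapGen P A Z y) +
      MvPolynomial.C (ℓ.cyc x X y Y z Z) *
        (swapGen P A X y * swapGen P A Y z * swapGen P A Z x) := by
    unfold P0 LinkingNumber.cyc
    rw [p X x Y y, p Y y Z z, p Z z X x, p Y x Z z, p Z y X x, p X z Y y]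
    simp only [map_add, map_mul]
    ring
  have gen0 : ∀ a : P, swapGen P A a a = 0 := fun a => by simp [swapGen]
  rw [main]
  by_cases hU : X = Y ∧ Y = Z
  · obtain ⟨rfl, rfl⟩ := hU
    have h := congrArg (MvPolynomial.C (σ := {q : P × P // q.1 ≠ q.2}))
      (ℓ.cyc_add_upper X x y z)
    rw [map_add, map_zero] at h
    linear_combination (swapGen P A X z * swapGen P A X x * swapGen P A X y) * h
  by_cases hL : x = y ∧ y = z
  · obtain ⟨rfl, rfl⟩ := hL
    have h := congrArg (MvPolynomial.C (σ := {q : P × P // q.1 ≠ q.2}))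
      (ℓ.cyc_add_upper x X Y Z)
    rw [map_add, map_zero] at h
    linear_combination (swapGen P A X x * swapGen P A Y x * swapGen P A Z x) * h
  have t1 : MvPolynomial.C (ℓ.cyc X x Y y Z z) *
      (swapGen P A X z * swapGen P A Y x * swapGen P A Z y) = 0 := by
    by_cases h1 : X = z
    · subst h1; simp [gen0]
    by_cases h2 : Y = x
    · subst h2; simp [gen0]
    by_cases h3 : Z = y
    · subst h3; simp [gen0]
    rw [ℓ.cyc_zero X x Y y Z z h1 h2 h3 hU hL]
    simp
  have t2 : MvPolynomial.C (ℓ.cyc x X y Y z Z) *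
      (swapGen P A X y * swapGen P A Y z * swapGen P A Z x) = 0 := by
    by_cases h1 : X = y
    · subst h1; simp [gen0]
    by_cases h2 : Y = z
    · subst h2; simp [gen0]
    by_cases h3 : Z = x
    · subst h3; simp [gen0]
    rw [ℓ.cyc_zero x X y Y z Z (Ne.symm h3) (Ne.symm h1) (Ne.symm h2) hL hU]
    simp
  rw [t1, t2, add_zero]
end

section
/- Let [·,·] be a linking number on a set P with values in a commutative ring A. In the algebra L(P) define P₁(X,x,Y,y,Z,z) := [Xx,Yy][Xx,Zz]·Xz·Yy·Zx + [Xx,Yy][Yy,Zz]·Xx·Yz·Zy + [Xx,Yy]·([Xy,Zz] + [Yx,Zz])·Xy·Yx·Zz. Then for all points X,x,Y,y,Z,z of P the cyclic sum P₁(X,x,Y,y,Z,z) + P₁(Y,y,Z,z,X,x) + P₁(Z,z,X,x,Y,y) equals 0 in L(P) (this is the vanishing of the coefficient of α in the cyclic sum of triple swapping brackets). -/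
/-- `P₁(X,x,Y,y,Z,z) := [Xx,Yy][Xx,Zz]·Xz·Yy·Zx + [Xx,Yy][Yy,Zz]·Xx·Yz·Zy
      + [Xx,Yy]·([Xy,Zz] + [Yx,Zz])·Xy·Yx·Zz` in `L(P)`. -/
noncomputable def P1 {P A : Type*} [CommRing A] [DecidableEq P] (ℓ : LinkingNumber P A)
    (X x Y y Z z : P) : SwapAlg P A :=
  MvPolynomial.C (ℓ.l X x Y y * ℓ.l X x Z z) *
      (swapGen P A X z * swapGen P A Y y * swapGen P A Z x) +
    MvPolynomial.C (ℓ.l X x Y y * ℓ.l Y y Z z) *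
      (swapGen P A X x * swapGen P A Y z * swapGen P A Z y) +
    MvPolynomial.C (ℓ.l X x Y y * (ℓ.l X y Z z + ℓ.l Y x Z z)) *
      (swapGen P A X y * swapGen P A Y x * swapGen P A Z z)

/-- The coefficient of `Xy·Yx·Zz` in the cyclic sum vanishes. -/
theorem coeff_aux {P A : Type*} [CommRing A] (ℓ : LinkingNumber P A) (X x Y y Z z : P) :
    ℓ.l X x Y y * (ℓ.l X y Z z + ℓ.l Y x Z z) + ℓ.l Y y Z z * ℓ.l Y y X x +
      ℓ.l Z z X x * ℓ.l X x Y y = 0 := by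
  have key : ℓ.l X y Z z + ℓ.l Y x Z z = ℓ.l X x Z z + ℓ.l Y y Z z := by
    linear_combination ℓ.antisymm_fst X y Z z + ℓ.antisymm_fst Y x Z z
      - ℓ.antisymm_fst X x Z z - ℓ.antisymm_fst Y y Z z
      - ℓ.cocycle Z z X y x - ℓ.cocycle Z z Y x y
      + ℓ.antisymm_snd Z z x y + ℓ.antisymm_snd Z z X x + ℓ.antisymm_snd Z z Y y
  linear_combination ℓ.l X x Y y * key + ℓ.l Y y Z z * ℓ.antisymm_fst X x Y y
    + ℓ.l X x Y y * ℓ.antisymm_fst X x Z z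

/-- The coefficient of `α` in the cyclic sum of triple swapping brackets vanishes:
`P₁(X,x,Y,y,Z,z) + P₁(Y,y,Z,z,X,x) + P₁(Z,z,X,x,Y,y) = 0` in `L(P)`. -/
theorem cyclic_sum_P1_eq_zero {P A : Type*} [CommRing A] [DecidableEq P]
    (ℓ : LinkingNumber P A) (X x Y y Z z : P) :
    P1 ℓ X x Y y Z z + P1 ℓ Y y Z z X x + P1 ℓ Z z X x Y y = 0 := by
  have h1 := congrArg (MvPolynomial.C (σ := {q : P × P // q.1 ≠ q.2})) (coeff_aux ℓ X x Y y Z z)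
  have h2 := congrArg (MvPolynomial.C (σ := {q : P × P // q.1 ≠ q.2})) (coeff_aux ℓ Y y Z z X x)
  have h3 := congrArg (MvPolynomial.C (σ := {q : P × P // q.1 ≠ q.2})) (coeff_aux ℓ Z z X x Y y)
  simp only [map_add, map_mul, map_zero] at h1 h2 h3
  simp only [P1, map_add, map_mul]
  linear_combination (swapGen P A X y * swapGen P A Y x * swapGen P A Z z) * h1
    + (swapGen P A Y z * swapGen P A Z y * swapGen P A X x) * h2
    + (swapGen P A Z x * swapGen P A X z * swapGen P A Y y) * h3
end

section
/- Let A be an integral domain and P a set. Let p ≥ 3 and let γ₁,…,γ_p be ordered pairs γᵢ = (γᵢ⁺, γᵢ⁻) of points of P such that γᵢ⁺ ≠ γᵢ⁻ and γ_{i+1}⁺ ≠ γᵢ⁻ for all i (indices mod p), and moreover γ₁⁺ ≠ γ₂⁻, γ₂⁺ ≠ γ_p⁻ and γ_p⁺ ≠ γ₁⁻. Then in the fraction field Q(P) one has the relation T(γ₁,…,γ_p) = T(γ₁,γ₂)·T(γ₁,γ_p)·T(γ₂,γ₃,…,γ_p) / T(γ_p,γ₂,γ₁). -/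
/-- The field of fractions `Q(P)` of the integral domain `L(P)`. -/
abbrev SwapField (P A : Type*) [CommRing A] [IsDomain A] := FractionRing (SwapAlg P A)

/-- The canonical embedding of `L(P)` into its field of fractions `Q(P)`. -/
noncomputable def toSF (P A : Type*) [CommRing A] [IsDomain A] (u : SwapAlg P A) :
    SwapField P A :=
  algebraMap (SwapAlg P A) (SwapField P A) u

/-- The elementary function
`T(γ₁,…,γ_k) := (∏ᵢ γ_{i+1}⁺γᵢ⁻) / (∏ᵢ γᵢ⁺γᵢ⁻)` in `Q(P)`, indices mod `k`. -/
noncomputable def elemT (P A : Type*) [CommRing A] [IsDomain A] [DecidableEq P]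
    (k : ℕ) [NeZero k] (γ : Fin k → P × P) : SwapField P A :=
  (∏ i : Fin k, toSF P A (swapGen P A ((γ (i + 1)).1) ((γ i).2))) /
    (∏ i : Fin k, toSF P A (swapGen P A ((γ i).1) ((γ i).2)))

theorem toSF_swapGen_ne_zero {P A : Type*} [CommRing A] [IsDomain A] [DecidableEq P]
    {X x : P} (h : X ≠ x) : toSF P A (swapGen P A X x) ≠ 0 := by
  unfold toSF swapGen
  rw [dif_neg h]
  intro h0
  have h' := (IsFractionRing.to_map_eq_zero_iff (K := SwapField P A)).1 h0
  exact MvPolynomial.X_ne_zero _ h'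

/-- The relation
`T(γ₁,…,γ_p) = T(γ₁,γ₂)·T(γ₁,γ_p)·T(γ₂,…,γ_p) / T(γ_p,γ₂,γ₁)` for a cyclic tuple
`γ₁,…,γ_p` with `p = q + 3 ≥ 3`: here `γ 0 = γ₁`, `γ 1 = γ₂` and
`γ (Fin.last (q+2)) = γ_p`. -/
theorem elemT_relation {P A : Type*} [CommRing A] [IsDomain A] [DecidableEq P]
    (q : ℕ) (γ : Fin (q + 3) → P × P)
    (h1 : ∀ i, (γ i).1 ≠ (γ i).2)
    (h2 : ∀ i, (γ (i + 1)).1 ≠ (γ i).2)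
    (h3 : (γ 0).1 ≠ (γ 1).2)
    (h4 : (γ 1).1 ≠ (γ (Fin.last (q + 2))).2)
    (h5 : (γ (Fin.last (q + 2))).1 ≠ (γ 0).2) :
    elemT P A (q + 3) γ =
      elemT P A 2 ![γ 0, γ 1] * elemT P A 2 ![γ 0, γ (Fin.last (q + 2))] *
          elemT P A (q + 2) (fun i => γ i.succ) /
        elemT P A 3 ![γ (Fin.last (q + 2)), γ 1, γ 0] := by
  have n1 : ∀ i, toSF P A (swapGen P A (γ i).1 (γ i).2) ≠ 0 :=
    fun i => toSF_swapGen_ne_zero (h1 i)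
  have n3 := toSF_swapGen_ne_zero (A := A) h3
  have n4 := toSF_swapGen_ne_zero (A := A) h4
  have n5 := toSF_swapGen_ne_zero (A := A) h5
  have d : (∏ i : Fin (q + 2), toSF P A (swapGen P A (γ i.succ).1 (γ i.succ).2)) ≠ 0 :=
    Finset.prod_ne_zero_iff.2 fun i _ => n1 _
  have n0 := n1 0
  have n1' := n1 1
  have nl := n1 (Fin.last (q + 2))
  have e1 : (∏ i : Fin (q + 3), toSF P A (swapGen P A (γ (i + 1)).1 (γ i).2)) =
      toSF P A (swapGen P A (γ 1).1 (γ 0).2) *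
      ((∏ j : Fin (q + 1),
        toSF P A (swapGen P A (γ j.succ.succ).1 (γ j.castSucc.succ).2)) *
      toSF P A (swapGen P A (γ 0).1 (γ (Fin.last (q + 2))).2)) := by
    rw [Fin.prod_univ_succ, Fin.prod_univ_castSucc]
    have a : ∀ j : Fin (q + 1), j.castSucc.succ + 1 = j.succ.succ := by
      intro j
      rw [← Fin.castSucc_succ, Fin.coeSucc_eq_succ]
    simp only [a, zero_add, Fin.succ_last, Fin.last_add_one]
  have e2 : (∏ i : Fin (q + 2), toSF P A (swapGen P A (γ (i + 1).succ).1 (γ i.succ).2)) =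
      (∏ j : Fin (q + 1),
        toSF P A (swapGen P A (γ j.succ.succ).1 (γ j.castSucc.succ).2)) *
      toSF P A (swapGen P A (γ 1).1 (γ (Fin.last (q + 2))).2) := by
    rw [Fin.prod_univ_castSucc]
    simp only [Fin.coeSucc_eq_succ, Fin.succ_last, Fin.last_add_one, Fin.succ_zero_eq_one]
  have e3 : (∏ i : Fin (q + 3), toSF P A (swapGen P A (γ i).1 (γ i).2)) =
      toSF P A (swapGen P A (γ 0).1 (γ 0).2) *
      (∏ i : Fin (q + 2), toSF P A (swapGen P A (γ i.succ).1 (γ i.succ).2)) :=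
    Fin.prod_univ_succ _
  have t2 : ∀ a b : P × P, elemT P A 2 ![a, b] =
      (toSF P A (swapGen P A b.1 a.2) * toSF P A (swapGen P A a.1 b.2)) /
      (toSF P A (swapGen P A a.1 a.2) * toSF P A (swapGen P A b.1 b.2)) := by
    intro a b
    simp [elemT, Fin.prod_univ_two]
  have t3 : ∀ a b c : P × P, elemT P A 3 ![a, b, c] =
      (toSF P A (swapGen P A b.1 a.2) * toSF P A (swapGen P A c.1 b.2) *
        toSF P A (swapGen P A a.1 c.2)) /
      (toSF P A (swapGen P A a.1 a.2) * toSF P A (swapGen P A b.1 b.2) *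
        toSF P A (swapGen P A c.1 c.2)) := by
    intro a b c
    unfold elemT
    rw [Fin.prod_univ_three, Fin.prod_univ_three]
    rfl
  rw [t2, t2, t3]
  unfold elemT
  rw [e1, e2, e3]
  generalize (∏ i : Fin (q + 2), toSF P A (swapGen P A (γ i.succ).1 (γ i.succ).2)) = D at *
  generalize (∏ j : Fin (q + 1),
        toSF P A (swapGen P A (γ j.succ.succ).1 (γ j.castSucc.succ).2)) = M at *
  clear e1 e2 e3 t2 t3 n1
  generalize toSF P A (swapGen P A (γ 0).1 (γ 0).2) = x1 at *
  generalize toSF P A (swapGen P A (γ 1).1 (γ 1).2) = x2 at *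
  generalize toSF P A (swapGen P A (γ (Fin.last (q + 2))).1 (γ (Fin.last (q + 2))).2) = x3 at *
  generalize toSF P A (swapGen P A (γ 0).1 (γ 1).2) = x4 at *
  generalize toSF P A (swapGen P A (γ 1).1 (γ (Fin.last (q + 2))).2) = x5 at *
  generalize toSF P A (swapGen P A (γ (Fin.last (q + 2))).1 (γ 0).2) = x6 at *
  field_simp
end

section
/- Let A be an integral domain and P a set. Let a, b, c, d be ordered pairs of points of P, written x = (x⁺, x⁻), such that a⁺ ≠ a⁻, b⁺ ≠ b⁻, c⁺ ≠ c⁻, d⁺ ≠ d⁻, d⁺ ≠ a⁻, c⁺ ≠ d⁻, a⁺ ≠ c⁻, b⁺ ≠ c⁻ and c⁺ ≠ b⁻. Then in the fraction field Q(P) one has T(a,b,c)·T(c,d) / (T(a,d,c)·T(c,b)) = [b⁺; d⁺; a⁻; c⁻], where [X;Y;x;y] := (Xx·Yy)/(Xy·Yx) is the cross fraction. -/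
/-- The cross fraction `[X;Y;x;y] = (Xx·Yy)/(Xy·Yx)` in `Q(P)`. -/
noncomputable def crossFrac (P A : Type*) [CommRing A] [IsDomain A] [DecidableEq P]
    (X Y x y : P) : SwapField P A :=
  (toSF P A (swapGen P A X x) * toSF P A (swapGen P A Y y)) /
    (toSF P A (swapGen P A X y) * toSF P A (swapGen P A Y x))

/-- `T(a,b,c)·T(c,d) / (T(a,d,c)·T(c,b)) = [b⁺; d⁺; a⁻; c⁻]`. -/
theorem elemT_cross_fraction {P A : Type*} [CommRing A] [IsDomain A] [DecidableEq P]
    (a b c d : P × P)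
    (ha : a.1 ≠ a.2) (hb : b.1 ≠ b.2) (hc : c.1 ≠ c.2) (hd : d.1 ≠ d.2)
    (hda : d.1 ≠ a.2) (hcd : c.1 ≠ d.2) (hac : a.1 ≠ c.2)
    (hbc : b.1 ≠ c.2) (hcb : c.1 ≠ b.2) :
    elemT P A 3 ![a, b, c] * elemT P A 2 ![c, d] /
        (elemT P A 3 ![a, d, c] * elemT P A 2 ![c, b]) =
      crossFrac P A b.1 d.1 a.2 c.2 := by
  have key : ∀ X x : P, X ≠ x → toSF P A (swapGen P A X x) ≠ 0 := by
    intro X x h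
    unfold toSF swapGen
    rw [dif_neg h]
    intro h0
    rw [map_eq_zero_iff _ (IsFractionRing.injective (SwapAlg P A) (SwapField P A))] at h0
    exact MvPolynomial.X_ne_zero _ h0
  have e3 : ∀ x y z : P × P, elemT P A 3 ![x, y, z] =
      (toSF P A (swapGen P A y.1 x.2) * toSF P A (swapGen P A z.1 y.2)
        * toSF P A (swapGen P A x.1 z.2)) /
      (toSF P A (swapGen P A x.1 x.2) * toSF P A (swapGen P A y.1 y.2)
        * toSF P A (swapGen P A z.1 z.2)) := by
    intro x y z
    unfold elemT
    rw [Fin.prod_univ_three, Fin.prod_univ_three]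
    rfl
  have e2 : ∀ x y : P × P, elemT P A 2 ![x, y] =
      (toSF P A (swapGen P A y.1 x.2) * toSF P A (swapGen P A x.1 y.2)) /
      (toSF P A (swapGen P A x.1 x.2) * toSF P A (swapGen P A y.1 y.2)) := by
    intro x y
    unfold elemT
    rw [Fin.prod_univ_two, Fin.prod_univ_two]
    rfl
  rw [e3, e3, e2, e2]
  unfold crossFrac
  have h1 := key _ _ ha
  have h2 := key _ _ hb
  have h3 := key _ _ hc
  have h4 := key _ _ hd
  have h5 := key _ _ hda
  have h6 := key _ _ hcd
  have h7 := key _ _ hac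
  have h8 := key _ _ hbc
  have h9 := key _ _ hcb
  generalize toSF P A (swapGen P A a.1 a.2) = x1 at *
  generalize toSF P A (swapGen P A b.1 b.2) = x2 at *
  generalize toSF P A (swapGen P A c.1 c.2) = x3 at *
  generalize toSF P A (swapGen P A d.1 d.2) = x4 at *
  generalize toSF P A (swapGen P A d.1 a.2) = x5 at *
  generalize toSF P A (swapGen P A c.1 d.2) = x6 at *
  generalize toSF P A (swapGen P A a.1 c.2) = x7 at *
  generalize toSF P A (swapGen P A b.1 c.2) = x8 at *
  generalize toSF P A (swapGen P A c.1 b.2) = x9 at *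
  generalize toSF P A (swapGen P A b.1 a.2) = y1 at *
  generalize toSF P A (swapGen P A d.1 c.2) = y2 at *
  clear key e3 e2
  field_simp
end

section
/- Let n ≥ 2 and fix any norm ‖·‖ on the real vector space of n×n real matrices. Let p₁,…,pₙ be n×n real matrices such that pᵢ·pⱼ = 0 whenever i ≠ j, pᵢ² = pᵢ and tr(pᵢ) = 1 for all i, and let λ₁ > λ₂ > … > λₙ > 0 be real numbers. Set A := Σ_{i=1}^{n} λᵢ·pᵢ. Then for every positive integer p one has tr(A^p) = Σ_{i=1}^{n} λᵢ^p > 0 and ‖ A^p / tr(A^p) − p₁ ‖ ≤ (λ₂/λ₁)^p · ( n·‖p₁‖ + Σ_{i=2}^{n} ‖pᵢ‖ ). -/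
/-- Quantitative convergence of `A^p / tr(A^p)` to the first spectral projector:
if `A = Σᵢ λᵢ pᵢ` with `p₁,…,pₙ` mutually annihilating idempotents of trace `1` and
`λ₁ > λ₂ > … > λₙ > 0`, then for every positive integer `p`,
`tr(A^p) = Σ λᵢ^p > 0` and
`‖A^p/tr(A^p) − p₁‖ ≤ (λ₂/λ₁)^p (n‖p₁‖ + Σ_{i=2}^n ‖pᵢ‖)`, for any norm `Nm` on the
space of `n × n` real matrices.  (Indices are `0`-based: `pm 0 = p₁`, `lam 1 = λ₂`,
and `Σ_{i=2}^n ‖pᵢ‖` is the sum over indices `i` with `1 ≤ i`.) -/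
theorem matrix_power_projector_asymptotics
    (n : ℕ) (hn : 2 ≤ n)
    (Nm : Matrix (Fin n) (Fin n) ℝ → ℝ)
    (hNadd : ∀ M N, Nm (M + N) ≤ Nm M + Nm N)
    (hNsmul : ∀ (c : ℝ) (M), Nm (c • M) = |c| * Nm M)
    (hNzero : ∀ M, Nm M = 0 ↔ M = 0)
    (pm : Fin n → Matrix (Fin n) (Fin n) ℝ)
    (lam : Fin n → ℝ)
    (horth : ∀ i j, i ≠ j → pm i * pm j = 0)
    (hidem : ∀ i, pm i * pm i = pm i)
    (htr : ∀ i, Matrix.trace (pm i) = 1)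
    (hanti : StrictAnti lam)
    (hpos : ∀ i, 0 < lam i)
    (A : Matrix (Fin n) (Fin n) ℝ)
    (hA : A = ∑ i, lam i • pm i)
    (p : ℕ) (hp : 0 < p) :
    Matrix.trace (A ^ p) = ∑ i, lam i ^ p ∧
    0 < Matrix.trace (A ^ p) ∧
    Nm ((Matrix.trace (A ^ p))⁻¹ • A ^ p - pm ⟨0, by omega⟩) ≤
      (lam ⟨1, by omega⟩ / lam ⟨0, by omega⟩) ^ p *
        ((n : ℝ) * Nm (pm ⟨0, by omega⟩) +
          ∑ i ∈ Finset.univ.filter (fun i : Fin n => 1 ≤ (i : ℕ)), Nm (pm i)) := by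
  have hpow : ∀ k : ℕ, 0 < k → A ^ k = ∑ i, lam i ^ k • pm i := by
    intro k hk
    induction k, hk using Nat.le_induction with
    | base => simp [hA]
    | succ k hk ih =>
      rw [pow_succ, ih, hA, Finset.sum_mul]
      refine Finset.sum_congr rfl fun i _ => ?_
      rw [Finset.mul_sum, Finset.sum_eq_single i]
      · rw [smul_mul_smul_comm, hidem, pow_succ]
      · intro j _ hj
        rw [smul_mul_smul_comm, horth i j (Ne.symm hj), smul_zero]
      · intro h
        exact absurd (Finset.mem_univ i) h
  have hT : Matrix.trace (A ^ p) = ∑ i, lam i ^ p := by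
    rw [hpow p hp, Matrix.trace_sum]
    refine Finset.sum_congr rfl fun i _ => ?_
    rw [Matrix.trace_smul, htr, smul_eq_mul, mul_one]
  have hle0 : lam ⟨0, by omega⟩ ^ p ≤ ∑ i, lam i ^ p :=
    Finset.single_le_sum (f := fun i => lam i ^ p) (fun i _ => (pow_pos (hpos i) p).le)
      (Finset.mem_univ _)
  have h0pos : 0 < lam ⟨0, by omega⟩ ^ p := pow_pos (hpos _) p
  have hTpos : 0 < ∑ i, lam i ^ p := lt_of_lt_of_le h0pos hle0
  refine ⟨hT, by rw [hT]; exact hTpos, ?_⟩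
  rw [hT, hpow p hp]
  set T := ∑ i, lam i ^ p with hTdef
  set p0 := pm ⟨0, by omega⟩ with hp0
  set r := (lam ⟨1, by omega⟩ / lam ⟨0, by omega⟩) ^ p with hr
  set S := Finset.univ.filter (fun i : Fin n => 1 ≤ (i : ℕ)) with hS
  have hNz : Nm 0 = 0 := (hNzero 0).2 rfl
  have hNneg : ∀ M, Nm (-M) = Nm M := by
    intro M
    have := hNsmul (-1) M
    simpa using this
  have hNnn : ∀ M, 0 ≤ Nm M := by
    intro M
    have := hNadd M (-M)
    rw [hNneg, add_neg_cancel, hNz] at this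
    linarith
  have hr0 : 0 ≤ r := pow_nonneg (div_nonneg (hpos _).le (hpos _).le) p
  have hdecomp : T⁻¹ • ∑ i, lam i ^ p • pm i - p0
      = ∑ i ∈ S, (lam i ^ p / T) • (pm i - p0) := by
    have h1 : ∑ i ∈ S, (lam i ^ p / T) • (pm i - p0)
        = ∑ i, (lam i ^ p / T) • (pm i - p0) := by
      refine Finset.sum_subset (Finset.subset_univ _) fun i _ hi => ?_
      have : i = ⟨0, by omega⟩ := by
        apply Fin.ext
        simp [hS] at hi
        simpa using hi
      rw [this, ← hp0, sub_self, smul_zero]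
    rw [h1]
    simp only [smul_sub, Finset.sum_sub_distrib]
    rw [← Finset.sum_smul, ← Finset.sum_div, ← hTdef, div_self hTpos.ne', one_smul,
      Finset.smul_sum]
    congr 1
    refine Finset.sum_congr rfl fun i _ => ?_
    rw [smul_smul, div_eq_inv_mul]
  rw [hdecomp]
  have hterm : ∀ i ∈ S, Nm ((lam i ^ p / T) • (pm i - p0)) ≤ r * (Nm (pm i) + Nm p0) := by
    intro i hi
    have hi1 : 1 ≤ (i : ℕ) := by simpa [hS] using hi
    have hc0 : 0 ≤ lam i ^ p / T := div_nonneg (pow_pos (hpos i) p).le hTpos.le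
    have hcr : lam i ^ p / T ≤ r := by
      rw [hr, div_pow]
      refine div_le_div₀ (pow_pos (hpos _) p).le ?_ h0pos hle0
      exact pow_le_pow_left₀ (hpos i).le (hanti.antitone (Fin.mk_le_of_le_val hi1)) p
    rw [hNsmul, abs_of_nonneg hc0]
    refine mul_le_mul hcr ?_ (hNnn _) hr0
    have := hNadd (pm i) (-p0)
    rwa [hNneg, ← sub_eq_add_neg] at this
  have hcard : (S.card : ℝ) ≤ n := by
    have := Finset.card_le_univ S
    rw [Fintype.card_fin] at this
    exact_mod_cast this
  calc Nm (∑ i ∈ S, (lam i ^ p / T) • (pm i - p0))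
      ≤ ∑ i ∈ S, Nm ((lam i ^ p / T) • (pm i - p0)) :=
        Finset.le_sum_of_subadditive Nm hNz.le hNadd S _
    _ ≤ ∑ i ∈ S, r * (Nm (pm i) + Nm p0) := Finset.sum_le_sum hterm
    _ = r * ((S.card : ℝ) * Nm p0 + ∑ i ∈ S, Nm (pm i)) := by
        rw [← Finset.mul_sum, Finset.sum_add_distrib, Finset.sum_const, nsmul_eq_mul, add_comm]
    _ ≤ r * ((n : ℝ) * Nm p0 + ∑ i ∈ S, Nm (pm i)) := by
        have := mul_le_mul_of_nonneg_right hcard (hNnn p0)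
        exact mul_le_mul_of_nonneg_left (by linarith) hr0
end
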